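/- Let γ ∈ {1, 2} and let G be a finite group of order 2^(3γ) together with elements a, b, c such that G is generated by {a, b, c}, a and c commute, orderOf a = orderOf b = 2^(γ+1), orderOf c = 2^(γ−1), orderOf [a,b] = 2^γ, the commutator [a,b] equals a² · c, the commutator [c,b] equals a⁻⁴ · c⁻², and a^(2^γ) = b^(2^γ) (this is the group G₄). Then the ordered Davenport constant of G equals its Loewy length: D_o(G) = L(G) = 2^(γ+2) − 3. -/

import Mathlib

/-- A list (ordered sequence) over `G` is product-one free if no nonempty
order-preserving sublist has product equal to the identity. -/
def OrderedProductOneFree {G : Type*} [Group G] (l : List G) : Prop :=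
  ∀ t : List G, t.Sublist l → t ≠ [] → t.prod ≠ 1

/-- The ordered Davenport constant: the smallest `k` such that every list of
elements of `G` of length at least `k` has a nonempty sublist with product one. -/
noncomputable def orderedDavenport (G : Type*) [Group G] : ℕ :=
  sInf {k : ℕ | ∀ l : List G, k ≤ l.length → ¬ OrderedProductOneFree l}
/-- The Loewy length of a finite `p`-group `G`: the least positive integer `n` such that
the `n`-th power of the Jacobson radical of the group algebra `𝔽_p[G]` vanishes. -/
noncomputable def loewyLength (p : ℕ) (G : Type*) [Group G] : ℕ :=
  sInf {n : ℕ | 0 < n ∧ (Ideal.jacobson (⊥ : Ideal (MonoidAlgebra (ZMod p) G))) ^ n = ⊥}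

/-- The relations of `G₄` in a monoid, with `M = 2 ^ (γ - 1)`, in the form used to
rewrite words to `a ^ i * c ^ j * b ^ k`. -/
structure G4Relations {G : Type*} [Monoid G] (M : ℕ) (a b c : G) : Prop where
  comm : Commute a c
  b_mul_a : b * a = a ^ 7 * c * b
  b_mul_c : b * c = a ^ 4 * c * b
  a_pow : a ^ (4 * M) = 1
  c_pow : c ^ M = 1
  b_pow : b ^ (2 * M) = a ^ (2 * M)

namespace G4Relations

section NormalForm

variable {G : Type*} [Monoid G] {M : ℕ} {a b c : G}

theorem map {H : Type*} [Monoid H] (h : G4Relations M a b c) (f : G →* H) :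
    G4Relations M (f a) (f b) (f c) where
  comm := h.comm.map f
  b_mul_a := by simp only [← map_mul, ← map_pow, h.b_mul_a]
  b_mul_c := by simp only [← map_mul, ← map_pow, h.b_mul_c]
  a_pow := by rw [← map_pow, h.a_pow, map_one]
  c_pow := by rw [← map_pow, h.c_pow, map_one]
  b_pow := by rw [← map_pow, ← map_pow, h.b_pow]

theorem b_mul_a_pow (h : G4Relations M a b c) (i : ℕ) :
    b * a ^ i = a ^ (7 * i) * c ^ i * b := by
  have hs : SemiconjBy b a (a ^ 7 * c) := h.b_mul_a
  rw [(hs.pow_right i).eq, (h.comm.pow_left 7).mul_pow, ← pow_mul]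

theorem b_mul_c_pow (h : G4Relations M a b c) (j : ℕ) :
    b * c ^ j = a ^ (4 * j) * c ^ j * b := by
  have hs : SemiconjBy b c (a ^ 4 * c) := h.b_mul_c
  rw [(hs.pow_right j).eq, (h.comm.pow_left 4).mul_pow, ← pow_mul]

theorem b_mul_normal (h : G4Relations M a b c) (i j k : ℕ) :
    b * (a ^ i * c ^ j * b ^ k) = a ^ (7 * i + 4 * j) * c ^ (i + j) * b ^ (k + 1) := by
  rw [← mul_assoc, ← mul_assoc, h.b_mul_a_pow, mul_assoc _ b, h.b_mul_c_pow, pow_succ' b, pow_add,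
    pow_add]
  simp only [mul_assoc]
  rw [← mul_assoc (c ^ i), ← mul_assoc (a ^ (4 * j)), (h.comm.pow_pow _ _).eq, mul_assoc]

theorem b_pow_mul_normal (h : G4Relations M a b c) (m i j k : ℕ) :
    ∃ u v, u % 2 = i % 2 ∧ v % 2 = (j + m * i) % 2 ∧
      b ^ m * (a ^ i * c ^ j * b ^ k) = a ^ u * c ^ v * b ^ (k + m) := by
  induction m with
  | zero => exact ⟨i, j, by simp⟩
  | succ m ih =>
    obtain ⟨u, v, hu, hv, huv⟩ := ih
    refine ⟨7 * u + 4 * v, u + v, by omega, by rw [Nat.succ_mul]; omega, ?_⟩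
    rw [pow_succ', mul_assoc, huv, h.b_mul_normal, add_assoc]

theorem c_mul_normal (h : G4Relations M a b c) (i j k : ℕ) :
    c * (a ^ i * c ^ j * b ^ k) = a ^ i * c ^ (j + 1) * b ^ k := by
  rw [pow_succ' c, ← mul_assoc, ← mul_assoc, ← (h.comm.pow_left i).eq]
  simp only [mul_assoc]

theorem exists_normal (h : G4Relations M a b c) (hgen : Submonoid.closure {a, b, c} = ⊤) (g : G) :
    ∃ i j k, a ^ i * c ^ j * b ^ k = g := by
  have hg : g ∈ Submonoid.closure {a, b, c} := hgen ▸ Submonoid.mem_top g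
  induction hg using Submonoid.closure_induction_left with
  | one => exact ⟨0, 0, 0, by simp⟩
  | mul_left x hx y _ ih =>
    obtain ⟨i, j, k, rfl⟩ := ih
    rcases hx with rfl | rfl | rfl
    · exact ⟨i + 1, j, k, by simp only [pow_succ', mul_assoc]⟩
    · exact ⟨_, _, _, (h.b_mul_normal i j k).symm⟩
    · exact ⟨_, _, _, (h.c_mul_normal i j k).symm⟩

theorem exists_reduced_normal (h : G4Relations M a b c) (hM : 0 < M)
    (hgen : Submonoid.closure {a, b, c} = ⊤) (g : G) :
    ∃ (i : Fin (4 * M)) (j : Fin M) (k : Fin (2 * M)),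
      a ^ (i : ℕ) * c ^ (j : ℕ) * b ^ (k : ℕ) = g := by
  obtain ⟨i, j, k, rfl⟩ := h.exists_normal hgen g
  refine ⟨⟨(i + 2 * M * (k / (2 * M))) % (4 * M), Nat.mod_lt _ (by omega)⟩,
    ⟨j % M, Nat.mod_lt _ hM⟩, ⟨k % (2 * M), Nat.mod_lt _ (by omega)⟩, ?_⟩
  dsimp only
  rw [← pow_eq_pow_mod _ h.a_pow, ← pow_eq_pow_mod _ h.c_pow]
  conv_rhs => rw [← Nat.div_add_mod k (2 * M)]
  rw [pow_add b, pow_mul b, h.b_pow, ← pow_mul, pow_add a, mul_assoc (a ^ i),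
    (h.comm.pow_pow _ _).eq]
  simp only [mul_assoc]

/-- Normal forms are unique when the order of `G` is as large as the relations allow. -/
theorem eq_zero_of_normal_eq_one [Fintype G] (h : G4Relations M a b c) (hM : 0 < M)
    (hgen : Submonoid.closure {a, b, c} = ⊤) (hcard : Fintype.card G = 4 * M * (M * (2 * M)))
    {i j k : ℕ} (hk : k < 2 * M) (he : a ^ i * c ^ j * b ^ k = 1) :
    4 * M ∣ i ∧ M ∣ j ∧ k = 0 := by
  let f : Fin (4 * M) × Fin M × Fin (2 * M) → G :=
    fun s => a ^ (s.1 : ℕ) * c ^ (s.2.1 : ℕ) * b ^ (s.2.2 : ℕ)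
  have hf : Function.Bijective f := by
    refine (Fintype.bijective_iff_surjective_and_card f).2 ⟨fun g => ?_, by simp [hcard]⟩
    obtain ⟨i, j, k, hg⟩ := h.exists_reduced_normal hM hgen g
    exact ⟨(i, j, k), hg⟩
  have key : f (⟨i % (4 * M), Nat.mod_lt _ (by omega)⟩, ⟨j % M, Nat.mod_lt _ hM⟩, ⟨k, hk⟩) =
      f (⟨0, by omega⟩, ⟨0, hM⟩, ⟨0, by omega⟩) := by
    simp only [f, pow_zero, mul_one]
    rw [← pow_eq_pow_mod _ h.a_pow, ← pow_eq_pow_mod _ h.c_pow, he]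
  simpa [Nat.dvd_iff_mod_eq_zero] using hf.injective key

/-- The longest product-one free list: `a ^ (4M - 1)`, `b ^ (2M - 1)`, `(ab) ^ (2M - 2)`. -/
theorem exists_productOneFree {G : Type*} [Group G] [Fintype G] {a b c : G}
    (h : G4Relations M a b c) (hM : M = 1 ∨ M = 2)
    (hgen : Submonoid.closure {a, b, c} = ⊤) (hcard : Fintype.card G = 4 * M * (M * (2 * M))) :
    ∃ l : List G, l.length = 8 * M - 4 ∧ OrderedProductOneFree l := by
  refine ⟨List.replicate (4 * M - 1) a ++ List.replicate (2 * M - 1) b ++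
    List.replicate (2 * M - 2) (a * b), by simp; omega, ?_⟩
  intro t ht hne hprod
  simp only [List.sublist_append_iff, List.sublist_replicate_iff] at ht
  obtain ⟨_, _, rfl, ⟨_, _, rfl, ⟨i, hi, rfl⟩, ⟨j, hj, rfl⟩⟩, ⟨k, hk, rfl⟩⟩ := ht
  simp only [List.prod_append, List.prod_replicate] at hprod
  have hred : ∀ {i j k : ℕ}, a ^ i * c ^ j * b ^ k = 1 → k < 4 * M →
      M ∣ j ∧ (k = 0 ∨ k = 2 * M) := fun {i j k} he hk => by
    by_cases hk' : k < 2 * M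
    · exact ⟨(h.eq_zero_of_normal_eq_one (by omega) hgen hcard hk' he).2.1,
        .inl (h.eq_zero_of_normal_eq_one (by omega) hgen hcard hk' he).2.2⟩
    · rw [← Nat.add_sub_cancel' (not_lt.1 hk'), pow_add b, h.b_pow, ← mul_assoc, mul_assoc (a ^ i),
        ← (h.comm.pow_pow _ _).eq, ← mul_assoc, ← pow_add] at he
      have := h.eq_zero_of_normal_eq_one (by omega) hgen hcard (by omega) he
      exact ⟨this.2.1, .inr (by omega)⟩
  obtain rfl | hk0 := Nat.eq_zero_or_pos k
  · have h0 : a ^ i * c ^ 0 * b ^ j = 1 := by simpa using hprod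
    have := h.eq_zero_of_normal_eq_one (by omega) hgen hcard (by omega) h0
    obtain rfl : i = 0 := Nat.eq_zero_of_dvd_of_lt this.1 (by omega)
    obtain rfl : j = 0 := this.2.2
    simp at hne
  obtain rfl : M = 2 := by omega
  obtain rfl | rfl : k = 1 ∨ k = 2 := by omega
  · obtain ⟨u, v, _, hv, huv⟩ := h.b_pow_mul_normal j 1 0 1
    have he : a ^ (i + u) * c ^ v * b ^ (1 + j) = 1 := by
      rw [← hprod, pow_add a, mul_assoc (a ^ i), mul_assoc (a ^ i), ← huv]
      simp [mul_assoc]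
    obtain ⟨h1, h2⟩ := hred he (by omega)
    obtain rfl : j = 3 := by omega
    omega
  · obtain ⟨u, v, _, hv, huv⟩ := h.b_pow_mul_normal j 8 1 2
    have hab : (a * b) ^ 2 = a ^ 8 * c ^ 1 * b ^ 2 := by
      rw [pow_two, mul_assoc, ← mul_assoc b, h.b_mul_a]
      simp only [pow_succ', pow_zero, mul_assoc, mul_one]
    have he : a ^ (i + u) * c ^ v * b ^ (2 + j) = 1 := by
      rw [← hprod, hab, pow_add a, mul_assoc (a ^ i), mul_assoc (a ^ i), ← huv, mul_assoc (a ^ i)]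
    obtain ⟨h1, h2⟩ := hred he (by omega)
    obtain rfl : j = 2 := by omega
    omega

end NormalForm

/-- The span of the monomials `x ^ i * z ^ j * y ^ k` of weight `i + 2 * j + k ≥ n`. -/
def weightFiltration {A : Type*} [Ring A] (x y z : A) (n : ℕ) : AddSubgroup A :=
  AddSubgroup.closure {m | ∃ i j k, n ≤ i + 2 * j + k ∧ m = x ^ i * z ^ j * y ^ k}

/-- Left multiplication by `r` raises the weight by at least `d`. -/
def RaisesWeight {A : Type*} [Ring A] (x y z : A) (d : ℕ) (r : A) : Prop :=
  ∀ n, ∀ w ∈ weightFiltration x y z n, r * w ∈ weightFiltration x y z (n + d)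

section Filtration

variable {A : Type*} [Ring A] {x y z : A} {d e : ℕ} {r s : A}

theorem monomial_mem {n i j k : ℕ} (h : n ≤ i + 2 * j + k) :
    x ^ i * z ^ j * y ^ k ∈ weightFiltration x y z n :=
  AddSubgroup.subset_closure ⟨i, j, k, h, rfl⟩

theorem weightFiltration_antitone : Antitone (weightFiltration x y z) := fun _ _ hmn =>
  AddSubgroup.closure_mono fun _ ⟨i, j, k, h, hm⟩ => ⟨i, j, k, hmn.trans h, hm⟩

theorem RaisesWeight.of_monomial
    (h : ∀ i j k, r * (x ^ i * z ^ j * y ^ k) ∈ weightFiltration x y z (i + 2 * j + k + d)) :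
    RaisesWeight x y z d r := by
  intro n w hw
  induction hw using AddSubgroup.closure_induction with
  | mem m hm =>
    obtain ⟨i, j, k, hn, rfl⟩ := hm
    exact weightFiltration_antitone (by omega) (h i j k)
  | zero => simp
  | add u v _ _ hu hv => rw [mul_add]; exact add_mem hu hv
  | neg u _ hu => rw [mul_neg]; exact neg_mem hu

theorem RaisesWeight.mono (hr : RaisesWeight x y z e r) (h : d ≤ e) : RaisesWeight x y z d r :=
  fun n w hw => weightFiltration_antitone (by omega) (hr n w hw)

theorem RaisesWeight.zero : RaisesWeight x y z d 0 := fun n w _ => by simp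

theorem RaisesWeight.one : RaisesWeight x y z 0 1 := fun n w hw => by simpa using hw

theorem RaisesWeight.add (hr : RaisesWeight x y z d r) (hs : RaisesWeight x y z d s) :
    RaisesWeight x y z d (r + s) := fun n w hw => by
  rw [add_mul]; exact add_mem (hr n w hw) (hs n w hw)

theorem RaisesWeight.mul (hr : RaisesWeight x y z d r) (hs : RaisesWeight x y z e s) :
    RaisesWeight x y z (d + e) (r * s) := fun n w hw => by
  rw [mul_assoc, add_comm d, ← add_assoc]; exact hr _ _ (hs n w hw)

theorem RaisesWeight.pow (hr : RaisesWeight x y z d r) (n : ℕ) :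
    RaisesWeight x y z (n * d) (r ^ n) := by
  induction n with
  | zero => simpa using RaisesWeight.one
  | succ n ih => rw [pow_succ, Nat.succ_mul]; exact ih.mul hr

theorem RaisesWeight.one_add_mul (hr : RaisesWeight x y z d (1 + r))
    (hs : RaisesWeight x y z d (1 + s)) (h2 : ∀ t : A, t + t = 0) :
    RaisesWeight x y z d (1 + r * s) := by
  have h : 1 + r * s = (1 + r) + (1 + s) + (1 + r) * (1 + s) := by
    have : (1 + r) + (1 + s) + (1 + r) * (1 + s) =
      1 + r * s + ((1 + 1) + (r + r) + (s + s)) := by noncomm_ring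
    rw [this, h2 1, h2 r, h2 s, add_zero, add_zero, add_zero]
  rw [h]
  exact (hr.add hs).add ((hr.mul hs).mono (by omega))

theorem RaisesWeight.one_add_pow (hr : RaisesWeight x y z d (1 + r)) (h2 : ∀ t : A, t + t = 0)
    (n : ℕ) : RaisesWeight x y z d (1 + r ^ n) := by
  induction n with
  | zero => rw [pow_zero, h2]; exact .zero
  | succ n ih => rw [pow_succ]; exact ih.one_add_mul hr h2

theorem one_add_sq (h2 : ∀ t : A, t + t = 0) (r : A) : (1 + r) ^ 2 = 1 + r ^ 2 := by
  have : (1 + r) ^ 2 = 1 + r ^ 2 + (r + r) := by noncomm_ring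
  rw [this, h2, add_zero]

end Filtration

section Ring

variable {A : Type*} [Ring A] {M : ℕ} {a b c : A}

theorem raises_x : RaisesWeight (1 + a) (1 + b) (1 + c) 1 (1 + a) := .of_monomial fun i j k => by
  rw [← mul_assoc, ← mul_assoc, ← pow_succ']
  exact monomial_mem (by omega)

theorem raises_z (h : G4Relations M a b c) :
    RaisesWeight (1 + a) (1 + b) (1 + c) 2 (1 + c) := .of_monomial fun i j k => by
  have hxz : Commute (1 + a) (1 + c) :=
    ((Commute.one_left _).add_left ((Commute.one_right a).add_right h.comm))
  rw [← mul_assoc, ← mul_assoc, ← (hxz.pow_left i).eq, mul_assoc (_ ^ i), ← pow_succ']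
  exact monomial_mem (by omega)

theorem raises_y (h : G4Relations M a b c) (h2 : ∀ t : A, t + t = 0) :
    RaisesWeight (1 + a) (1 + b) (1 + c) 1 (1 + b) := .of_monomial fun i j k => by
  have hx : RaisesWeight (1 + a) (1 + b) (1 + c) 1 (1 + a) := raises_x
  have hz := h.raises_z
  have hx2 : RaisesWeight (1 + a) (1 + b) (1 + c) 2 (1 + a ^ 2) := by
    rw [← one_add_sq h2]; exact hx.pow 2
  have hx4 : RaisesWeight (1 + a) (1 + b) (1 + c) 4 (1 + a ^ 4) := by
    rw [show a ^ 4 = (a ^ 2) ^ 2 by rw [← pow_mul], ← one_add_sq h2]; exact hx2.pow 2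
  have hunit : ∀ {r : A}, RaisesWeight (1 + a) (1 + b) (1 + c) 1 (1 + r) →
      RaisesWeight (1 + a) (1 + b) (1 + c) 0 r := fun {r} hr => by
    have : r = 1 + (1 + r) := by rw [← add_assoc, h2, zero_add]
    rw [this]; exact RaisesWeight.one.add (hr.mono zero_le_one)
  -- the conjugates of `x` and `z` by `b` have the same leading terms as `x` and `z`
  have hx' : RaisesWeight (1 + a) (1 + b) (1 + c) 1 (1 + a ^ 7 * c) :=
    (hx.one_add_pow h2 7).one_add_mul (hz.mono one_le_two) h2
  have hxx' : RaisesWeight (1 + a) (1 + b) (1 + c) 2 ((1 + a) + (1 + a ^ 7 * c)) := by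
    have : (1 + a) + (1 + a ^ 7 * c) = a * (1 + (a ^ 2) ^ 3 * c) + (1 + 1) := by noncomm_ring
    rw [this, h2, add_zero]
    simpa using (hunit hx).mul ((hx2.one_add_pow h2 3).one_add_mul hz h2)
  have hz' : RaisesWeight (1 + a) (1 + b) (1 + c) 2 (1 + a ^ 4 * c) :=
    (hx4.mono (by omega)).one_add_mul hz h2
  have hzz' : RaisesWeight (1 + a) (1 + b) (1 + c) 4 ((1 + c) + (1 + a ^ 4 * c)) := by
    have : (1 + c) + (1 + a ^ 4 * c) = (1 + a ^ 4) * c + (1 + 1) := by noncomm_ring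
    rw [this, h2, add_zero]
    simpa using hx4.mul (hunit (hz.mono one_le_two))
  have swap : ∀ r r' : A, b * r = r' * b →
      (1 + b) * (1 + r) = ((1 + r) + (1 + r')) + (1 + r') * (1 + b) := fun r r' hr => by
    have e : ((1 + r) + (1 + r')) + (1 + r') * (1 + b) =
      1 + b + r + r' * b + ((1 + 1) + (r' + r')) := by noncomm_ring
    rw [e, ← hr, h2, h2]; noncomm_ring
  induction i with
  | zero =>
    induction j with
    | zero =>
      have : (1 + b) * ((1 + a) ^ 0 * (1 + c) ^ 0 * (1 + b) ^ k) =
        (1 + a) ^ 0 * (1 + c) ^ 0 * (1 + b) ^ (k + 1) := by simp [pow_succ']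
      rw [this]
      exact monomial_mem (by omega)
    | succ j ih =>
      have e : (1 + b) * ((1 + a) ^ 0 * (1 + c) ^ (j + 1) * (1 + b) ^ k) =
          ((1 + c) + (1 + a ^ 4 * c)) * ((1 + a) ^ 0 * (1 + c) ^ j * (1 + b) ^ k) +
          (1 + a ^ 4 * c) * ((1 + b) * ((1 + a) ^ 0 * (1 + c) ^ j * (1 + b) ^ k)) := by
        rw [← mul_assoc (1 + a ^ 4 * c), ← add_mul, ← swap _ _ h.b_mul_c]
        simp only [pow_succ', mul_assoc, pow_zero, one_mul]
      rw [e]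
      exact add_mem (weightFiltration_antitone (by omega) (hzz' _ _ (monomial_mem le_rfl)))
        (weightFiltration_antitone (by omega) (hz' _ _ ih))
  | succ i ih =>
    have e : (1 + b) * ((1 + a) ^ (i + 1) * (1 + c) ^ j * (1 + b) ^ k) =
        ((1 + a) + (1 + a ^ 7 * c)) * ((1 + a) ^ i * (1 + c) ^ j * (1 + b) ^ k) +
        (1 + a ^ 7 * c) * ((1 + b) * ((1 + a) ^ i * (1 + c) ^ j * (1 + b) ^ k)) := by
      rw [← mul_assoc (1 + a ^ 7 * c), ← add_mul, ← swap _ _ h.b_mul_a]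
      simp only [pow_succ', mul_assoc]
    rw [e]
    exact add_mem (weightFiltration_antitone (by omega) (hxx' _ _ (monomial_mem le_rfl)))
      (weightFiltration_antitone (by omega) (hx' _ _ ih))

/-- Nonzero monomials have weight at most `8 * M - 4`. -/
theorem weightFiltration_eq_bot (h : G4Relations M a b c) (h2 : ∀ t : A, t + t = 0)
    (hM : M = 1 ∨ M = 2) : weightFiltration (1 + a) (1 + b) (1 + c) (8 * M - 3) = ⊥ := by
  have h4 : ∀ r : A, (1 + r) ^ 4 = 1 + r ^ 4 := fun r => by
    rw [show 4 = 2 * 2 from rfl, pow_mul, one_add_sq h2, one_add_sq h2, ← pow_mul]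
  have h8 : ∀ r : A, (1 + r) ^ 8 = 1 + r ^ 8 := fun r => by
    rw [show 8 = 4 * 2 from rfl, pow_mul, h4, one_add_sq h2, ← pow_mul]
  have hx : (1 + a) ^ (4 * M) = 0 := by
    have : (1 + a) ^ (4 * M) = 1 + a ^ (4 * M) := by
      rcases hM with rfl | rfl <;> simp [h4, h8]
    rw [this, h.a_pow, h2]
  have hz : (1 + c) ^ M = 0 := by
    have : (1 + c) ^ M = 1 + c ^ M := by rcases hM with rfl | rfl <;> simp [one_add_sq h2]
    rw [this, h.c_pow, h2]
  have hy : (1 + b) ^ (2 * M) = (1 + a) ^ (2 * M) := by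
    have : ∀ r : A, (1 + r) ^ (2 * M) = 1 + r ^ (2 * M) := fun r => by
      rcases hM with rfl | rfl <;> simp [one_add_sq h2, h4]
    rw [this, this, h.b_pow]
  have hxz : Commute (1 + a) (1 + c) :=
    ((Commute.one_left _).add_left ((Commute.one_right a).add_right h.comm))
  have key : ∀ k i j : ℕ, 8 * M - 3 ≤ i + 2 * j + k →
      (1 + a) ^ i * (1 + c) ^ j * (1 + b) ^ k = 0 := by
    intro k
    induction k using Nat.strong_induction_on with
    | _ k ih =>
      intro i j hw
      by_cases hk : 2 * M ≤ k
      · have := ih (k - 2 * M) (by omega) (i + 2 * M) j (by omega)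
        rw [← this, pow_add (1 + a), mul_assoc (_ ^ i) (_ ^ (2 * M)), (hxz.pow_pow (2 * M) j).eq, ← hy]
        conv_lhs => rw [← Nat.add_sub_cancel' hk, pow_add (1 + b)]
        simp only [mul_assoc]
      · by_cases hj : M ≤ j
        · rw [pow_eq_zero_of_le hj hz]; simp
        · rw [pow_eq_zero_of_le (by omega : 4 * M ≤ i) hx]; simp
  refine AddSubgroup.closure_eq_bot_iff.2 ?_
  rintro _ ⟨i, j, k, hw, rfl⟩
  exact key k i j hw

end Ring

end G4Relations

section GroupAlgebra

variable {G : Type*} [Group G]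

/-- The augmentation map of `𝔽₂[G]`. -/
noncomputable def augmentation (G : Type*) [Group G] : MonoidAlgebra (ZMod 2) G →ₐ[ZMod 2] ZMod 2 :=
  MonoidAlgebra.lift (ZMod 2) (ZMod 2) G 1

theorem augmentation_of (g : G) : augmentation G (MonoidAlgebra.of (ZMod 2) G g) = 1 := by
  simp [augmentation]

theorem groupAlgebra_add_self (r : MonoidAlgebra (ZMod 2) G) : r + r = 0 := by
  rw [← two_smul (ZMod 2) r, show (2 : ZMod 2) = 0 from rfl, zero_smul]

theorem jacobson_le_ker_augmentation :
    Ideal.jacobson (⊥ : Ideal (MonoidAlgebra (ZMod 2) G)) ≤ RingHom.ker (augmentation G) := by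
  have : (RingHom.ker (augmentation G)).IsMaximal :=
    RingHom.ker_isMaximal_of_surjective _ fun t => ⟨algebraMap _ _ t, (augmentation G).commutes t⟩
  exact sInf_le ⟨bot_le, this⟩

namespace G4Relations

variable {M : ℕ} {a b c : G}

/-- `RaisesWeight` in `𝔽₂[G]` for `x = 1 + a`, `y = 1 + b`, `z = 1 + c`. -/
abbrev RaisesAlgebraWeight (a b c : G) : ℕ → MonoidAlgebra (ZMod 2) G → Prop :=
  RaisesWeight (1 + MonoidAlgebra.of (ZMod 2) G a) (1 + MonoidAlgebra.of (ZMod 2) G b)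
    (1 + MonoidAlgebra.of (ZMod 2) G c)

theorem raises_one_add_of (h : G4Relations M a b c) (hgen : Submonoid.closure {a, b, c} = ⊤)
    (g : G) : RaisesAlgebraWeight a b c 1 (1 + MonoidAlgebra.of (ZMod 2) G g) := by
  have h' := h.map (MonoidAlgebra.of (ZMod 2) G)
  have hg : g ∈ Submonoid.closure {a, b, c} := hgen ▸ Submonoid.mem_top g
  induction hg using Submonoid.closure_induction with
  | mem g hg =>
    rcases hg with rfl | rfl | rfl
    · exact raises_x
    · exact h'.raises_y groupAlgebra_add_self
    · exact h'.raises_z.mono one_le_two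
  | one => rw [map_one, groupAlgebra_add_self]; exact .zero
  | mul g g' _ _ hg hg' => rw [map_mul]; exact hg.one_add_mul hg' groupAlgebra_add_self

theorem raises_of_mem_ker (h : G4Relations M a b c) (hgen : Submonoid.closure {a, b, c} = ⊤)
    {r : MonoidAlgebra (ZMod 2) G} (hr : r ∈ RingHom.ker (augmentation G)) :
    RaisesAlgebraWeight a b c 1 r := by
  have key : ∀ r, RaisesAlgebraWeight a b c 1 (algebraMap _ _ (augmentation G r) + r) := by
    intro r
    induction r using MonoidAlgebra.induction_on with
    | of g => rw [augmentation_of, map_one]; exact h.raises_one_add_of hgen g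
    | add r s hr hs =>
      rw [map_add, map_add, add_add_add_comm]
      exact hr.add hs
    | smul t r hr =>
      have ht : t = 0 ∨ t = 1 := by revert t; decide
      rcases ht with rfl | rfl
      · simpa using RaisesWeight.zero
      · simpa using hr
  simpa [RingHom.mem_ker.1 hr] using key r

theorem raises_zero (h : G4Relations M a b c) (hgen : Submonoid.closure {a, b, c} = ⊤)
    (r : MonoidAlgebra (ZMod 2) G) : RaisesAlgebraWeight a b c 0 r := by
  by_cases hr : augmentation G r = 0
  · exact (h.raises_of_mem_ker hgen hr).mono zero_le_one
  · have h1 : 1 + r ∈ RingHom.ker (augmentation G) := by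
      rw [RingHom.mem_ker, map_add, map_one]
      generalize augmentation G r = t at hr
      revert t; decide
    have := RaisesWeight.one.add ((h.raises_of_mem_ker hgen h1).mono zero_le_one)
    rwa [← add_assoc, groupAlgebra_add_self, zero_add] at this

theorem eq_zero_of_raises (h : G4Relations M a b c) (hM : M = 1 ∨ M = 2)
    {r : MonoidAlgebra (ZMod 2) G} (hr : RaisesAlgebraWeight a b c (8 * M - 3) r) : r = 0 := by
  have h1 := hr 0 1 (by simpa using monomial_mem (i := 0) (j := 0) (k := 0) le_rfl)
  rwa [zero_add, mul_one, (h.map _).weightFiltration_eq_bot groupAlgebra_add_self hM,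
    AddSubgroup.mem_bot] at h1

theorem jacobson_pow_eq_bot (h : G4Relations M a b c) (hgen : Submonoid.closure {a, b, c} = ⊤)
    (hM : M = 1 ∨ M = 2) :
    (Ideal.jacobson (⊥ : Ideal (MonoidAlgebra (ZMod 2) G))) ^ (8 * M - 3) = ⊥ := by
  have key : ∀ n, ∀ r ∈ (Ideal.jacobson (⊥ : Ideal (MonoidAlgebra (ZMod 2) G))) ^ n,
      RaisesAlgebraWeight a b c n r := by
    intro n
    induction n with
    | zero => exact fun r _ => h.raises_zero hgen r
    | succ n ih =>
      intro r hr
      rw [Submodule.pow_succ] at hr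
      exact Submodule.smul_induction_on hr
        (fun u hu v hv =>
          (ih u hu).mul (h.raises_of_mem_ker hgen (jacobson_le_ker_augmentation hv)))
        fun u v hu hv => hu.add hv
  exact (Submodule.eq_bot_iff _).2 fun r hr => h.eq_zero_of_raises hM (key _ r hr)

theorem one_sub_of_mem_jacobson (h : G4Relations M a b c)
    (hgen : Submonoid.closure {a, b, c} = ⊤) (hM : M = 1 ∨ M = 2) (g : G) :
    1 - MonoidAlgebra.of (ZMod 2) G g ∈
      Ideal.jacobson (⊥ : Ideal (MonoidAlgebra (ZMod 2) G)) := by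
  refine Ideal.mem_jacobson_iff.2 fun r => ?_
  have hr : r * (1 - MonoidAlgebra.of (ZMod 2) G g) ∈ RingHom.ker (augmentation G) := by
    rw [RingHom.mem_ker, map_mul, map_sub, map_one, augmentation_of, sub_self, mul_zero]
  have hnil : IsNilpotent (r * (1 - MonoidAlgebra.of (ZMod 2) G g)) :=
    ⟨8 * M - 3, h.eq_zero_of_raises hM
      (by simpa only [mul_one] using (h.raises_of_mem_ker hgen hr).pow (8 * M - 3))⟩
  obtain ⟨u, hu⟩ := hnil.isUnit_one_add
  refine ⟨↑u⁻¹, ?_⟩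
  have : (↑u⁻¹ : MonoidAlgebra (ZMod 2) G) * (1 + r * (1 - MonoidAlgebra.of (ZMod 2) G g)) = 1 := by
    rw [← hu, Units.inv_mul]
  rw [Ideal.mem_bot, sub_eq_zero]
  rw [mul_add, mul_one, add_comm, ← mul_assoc] at this
  exact this

end G4Relations

/-- Expanding `∏ (1 - gᵢ)`, the identity of `G` appears only as the empty product. -/
theorem OrderedProductOneFree.coeff_prod_one_sub {R : Type*} [Ring R] {l : List G}
    (hl : OrderedProductOneFree l) :
    (l.map fun g => 1 - MonoidAlgebra.of R G g).prod.coeff 1 = 1 := by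
  have key : ∀ (l : List G) (h : G), (∀ t : List G, t.Sublist l → h * t.prod ≠ 1) →
      (MonoidAlgebra.of R G h * (l.map fun g => 1 - MonoidAlgebra.of R G g).prod).coeff 1 = 0 := by
    intro l
    induction l with
    | nil =>
      intro h hh
      have := hh [] (List.Sublist.refl _)
      simp_all
    | cons g l ih =>
      intro h hh
      have h1 := ih h fun t ht => hh t (ht.cons g)
      have h2 := ih (h * g) fun t ht => by
        simpa [mul_assoc] using hh (g :: t) (ht.cons_cons g)
      rw [List.map_cons, List.prod_cons, sub_mul, one_mul, mul_sub, ← mul_assoc, ← map_mul]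
      rw [MonoidAlgebra.coeff_sub, Finsupp.sub_apply, h1, h2, sub_zero]
  induction l with
  | nil => simp [MonoidAlgebra.one_def]
  | cons g l ih =>
    have h1 := ih fun t ht => hl t (ht.cons g)
    have h2 := key l g fun t ht => by
      simpa using hl (g :: t) (ht.cons_cons g) (by simp)
    rw [List.map_cons, List.prod_cons, sub_mul, one_mul]
    rw [MonoidAlgebra.coeff_sub, Finsupp.sub_apply, h1, h2, sub_zero]

theorem list_prod_mem_pow {R : Type*} [Ring R] {I : Ideal R} :
    ∀ l : List R, (∀ r ∈ l, r ∈ I) → l.prod ∈ I ^ l.length := by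
  intro l
  induction l using List.reverseRecOn with
  | nil => intro _; simp [Submodule.pow_zero]
  | append_singleton l r ih =>
    intro h
    rw [List.prod_append, List.prod_singleton, List.length_append, List.length_singleton,
      Submodule.pow_succ]
    exact Ideal.mul_mem_mul (ih fun s hs => h s (by simp [hs])) (h r (by simp))

theorem OrderedProductOneFree.jacobson_pow_ne_bot {l : List G} (hl : OrderedProductOneFree l)
    (hJ : ∀ g : G, 1 - MonoidAlgebra.of (ZMod 2) G g ∈
      Ideal.jacobson (⊥ : Ideal (MonoidAlgebra (ZMod 2) G))) {n : ℕ} (hn : n ≤ l.length) :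
    (Ideal.jacobson (⊥ : Ideal (MonoidAlgebra (ZMod 2) G))) ^ n ≠ ⊥ := by
  intro h
  have hl' : OrderedProductOneFree (l.take n) := fun t ht => hl t (ht.trans (List.take_sublist _ _))
  have hmem := list_prod_mem_pow ((l.take n).map fun g => 1 - MonoidAlgebra.of (ZMod 2) G g)
    (I := Ideal.jacobson (⊥ : Ideal (MonoidAlgebra (ZMod 2) G))) (by
      simp only [List.mem_map]
      rintro _ ⟨g, _, rfl⟩
      exact hJ g)
  have hc := hl'.coeff_prod_one_sub (R := ZMod 2)
  rw [List.length_map, List.length_take, min_eq_left hn, h, Ideal.mem_bot] at hmem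
  rw [hmem] at hc
  simp at hc

theorem orderedDavenport_loewyLength_eq {n : ℕ}
    (hJ : ∀ g : G, 1 - MonoidAlgebra.of (ZMod 2) G g ∈
      Ideal.jacobson (⊥ : Ideal (MonoidAlgebra (ZMod 2) G)))
    (hn : (Ideal.jacobson (⊥ : Ideal (MonoidAlgebra (ZMod 2) G))) ^ (n + 1) = ⊥)
    {l : List G} (hlen : l.length = n) (hl : OrderedProductOneFree l) :
    orderedDavenport G = n + 1 ∧ loewyLength 2 G = n + 1 := by
  constructor
  · refine IsLeast.csInf_eq ⟨fun l hl hfree => hfree.jacobson_pow_ne_bot hJ hl hn, fun k hk => ?_⟩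
    by_contra hlt
    exact hk l (by omega) hl
  · refine IsLeast.csInf_eq ⟨⟨n.succ_pos, hn⟩, fun k hk => ?_⟩
    by_contra hlt
    exact hl.jacobson_pow_ne_bot hJ (by omega) hk.2

end GroupAlgebra

theorem g4Relations_of_commutators {γ : ℕ} (hγ : γ = 1 ∨ γ = 2) {G : Type*} [Group G] {a b c : G}
    (hac : a * c = c * a) (hoa : orderOf a = 2 ^ (γ + 1)) (hoc : orderOf c = 2 ^ (γ - 1))
    (hab : a⁻¹ * b⁻¹ * a * b = a ^ 2 * c)
    (hcb : c⁻¹ * b⁻¹ * c * b = a ^ (-4 : ℤ) * c ^ (-2 : ℤ))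
    (hpow : a ^ 2 ^ γ = b ^ 2 ^ γ) : G4Relations (2 ^ (γ - 1)) a b c := by
  have h4 : 4 * 2 ^ (γ - 1) = 2 ^ (γ + 1) := by rcases hγ with rfl | rfl <;> rfl
  have h2 : 2 * 2 ^ (γ - 1) = 2 ^ γ := by rcases hγ with rfl | rfl <;> rfl
  have ha8 : a ^ 8 = 1 := orderOf_dvd_iff_pow_eq_one.1 (by
    rw [hoa]; rcases hγ with rfl | rfl <;> decide)
  have hc2 : c ^ 2 = 1 := orderOf_dvd_iff_pow_eq_one.1 (by
    rw [hoc]; rcases hγ with rfl | rfl <;> decide)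
  have hcomm : Commute a c := hac
  have ha : SemiconjBy b (a ^ 3 * c) a := by
    have : a * b = b * (a ^ 3 * c) := by
      calc a * b = b * (a * (a⁻¹ * b⁻¹ * a * b)) := by group
        _ = b * (a ^ 3 * c) := by rw [hab, ← mul_assoc a, ← pow_succ']
    exact this.symm
  have hc : SemiconjBy b (a ^ 4 * c) c := by
    have e4 : a ^ (-4 : ℤ) = a ^ 4 := by
      rw [zpow_neg, inv_eq_iff_mul_eq_one, zpow_ofNat]; exact (pow_add a 4 4).symm.trans ha8
    have e2 : c ^ (-2 : ℤ) = 1 := by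
      rw [zpow_neg, inv_eq_one, zpow_ofNat]; exact hc2
    have : c * b = b * (a ^ 4 * c) := by
      calc c * b = b * (c * (c⁻¹ * b⁻¹ * c * b)) := by group
        _ = b * (a ^ 4 * c) := by rw [hcb, e4, e2, mul_one, (hcomm.pow_left 4).eq]
    exact this.symm
  refine ⟨hcomm, ?_, ?_, ?_, ?_, ?_⟩
  · have h := ((ha.pow_right 7).mul_right hc).eq
    have e : (a ^ 3 * c) ^ 7 * (a ^ 4 * c) = a := by
      rw [(hcomm.pow_left 3).mul_pow, mul_assoc, ← mul_assoc (c ^ 7),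
        ← (hcomm.pow_pow 4 7).eq, mul_assoc, ← pow_succ, ← mul_assoc, ← pow_mul, ← pow_add]
      rw [show 3 * 7 + 4 = 8 * 3 + 1 from rfl, show 7 + 1 = 2 * 4 from rfl, pow_succ, pow_mul,
        pow_mul, ha8, hc2]
      simp
    rwa [e] at h
  · have h := ((ha.pow_right 4).mul_right hc).eq
    have e : (a ^ 3 * c) ^ 4 * (a ^ 4 * c) = c := by
      rw [(hcomm.pow_left 3).mul_pow, show c ^ 4 = (c ^ 2) ^ 2 by rw [← pow_mul], hc2, ← pow_mul,
        one_pow, mul_one, ← mul_assoc, ← pow_add, show 3 * 4 + 4 = 8 * 2 from rfl, pow_mul, ha8]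
      simp
    rwa [e] at h
  · rw [h4, ← hoa, pow_orderOf_eq_one]
  · rw [← hoc, pow_orderOf_eq_one]
  · rw [h2, hpow]

/-- For the group `G₄` with `γ ∈ {1, 2}`, the ordered Davenport
constant equals the Loewy length: `D_o(G) = L(G) = 2^(γ+2) - 3`. -/
theorem orderedDavenport_eq_loewyLength_G4 (γ : ℕ) (hγ : γ = 1 ∨ γ = 2)
    (G : Type*) [Group G] [Fintype G] (a b c : G)
    (hcard : Fintype.card G = 2 ^ (3 * γ))
    (hgen : Subgroup.closure {a, b, c} = ⊤)
    (hac : a * c = c * a)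
    (hoa : orderOf a = 2 ^ (γ + 1)) (hob : orderOf b = 2 ^ (γ + 1))
    (hoc : orderOf c = 2 ^ (γ - 1))
    (hoab : orderOf (a⁻¹ * b⁻¹ * a * b) = 2 ^ γ)
    (hab : a⁻¹ * b⁻¹ * a * b = a ^ 2 * c)
    (hcb : c⁻¹ * b⁻¹ * c * b = a ^ (-4 : ℤ) * c ^ (-2 : ℤ))
    (hpow : a ^ 2 ^ γ = b ^ 2 ^ γ) :
    orderedDavenport G = loewyLength 2 G ∧ loewyLength 2 G = 2 ^ (γ + 2) - 3 := by
  have hgen' : Submonoid.closure {a, b, c} = ⊤ := by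
    rw [← Subgroup.closure_toSubmonoid_of_finite, hgen, Subgroup.top_toSubmonoid]
  have h := g4Relations_of_commutators hγ hac hoa hoc hab hcb hpow
  have hM : 2 ^ (γ - 1) = 1 ∨ 2 ^ (γ - 1) = 2 := by rcases hγ with rfl | rfl <;> simp
  have hcard' : Fintype.card G = 4 * 2 ^ (γ - 1) * (2 ^ (γ - 1) * (2 * 2 ^ (γ - 1))) := by
    rw [hcard]; rcases hγ with rfl | rfl <;> rfl
  obtain ⟨l, hlen, hl⟩ := h.exists_productOneFree hM hgen' hcard'
  have hn : 8 * 2 ^ (γ - 1) - 3 = 8 * 2 ^ (γ - 1) - 4 + 1 := by omega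
  have hγ' : 2 ^ (γ + 2) - 3 = 8 * 2 ^ (γ - 1) - 4 + 1 := by
    rcases hγ with rfl | rfl <;> rfl
  obtain ⟨hD, hL⟩ := orderedDavenport_loewyLength_eq (h.one_sub_of_mem_jacobson hgen' hM)
    (hn ▸ h.jacobson_pow_eq_bot hgen' hM) hlen hl
  exact ⟨hD.trans hL.symm, hL.trans hγ'.symm⟩
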